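/- For all integers k ≥ 2 and n ≥ 2k+1, there exists a k-latin square of order n which is not fully separable. -/

import Mathlib

/-- A `k`-latin square of order `n`: an `n × n` array of multisets of symbols from
`Fin n`, each cell of cardinality `k`, such that each symbol occurs exactly `k` times
in each row and exactly `k` times in each column (counting multiplicity). -/
def IsMultiLatin (n k : ℕ) (L : Fin n → Fin n → Multiset (Fin n)) : Prop :=
  (∀ i j, (L i j).card = k) ∧
  (∀ i s, (∑ j, (L i j).count s) = k) ∧
  (∀ j s, (∑ i, (L i j).count s) = k)

/-- A partial `k`-latin square of order `n`: each cell has cardinality at most `k`,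
and each symbol occurs at most `k` times in each row and in each column. -/
def IsPartialMultiLatin (n k : ℕ) (P : Fin n → Fin n → Multiset (Fin n)) : Prop :=
  (∀ i j, (P i j).card ≤ k) ∧
  (∀ i s, (∑ j, (P i j).count s) ≤ k) ∧
  (∀ j s, (∑ i, (P i j).count s) ≤ k)

/-- An `m × n` `k`-latin rectangle: a partial `k`-latin square of order `n` in which
every cell of the first `m` rows contains exactly `k` symbols and the remaining rows
are empty. -/
def IsLatinRectangle (m n k : ℕ) (P : Fin n → Fin n → Multiset (Fin n)) : Prop :=
  IsPartialMultiLatin n k P ∧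
  (∀ (i j : Fin n), (i : ℕ) < m → (P i j).card = k) ∧
  (∀ (i j : Fin n), m ≤ (i : ℕ) → P i j = 0)

/-- A `k`-latin square is separable if it is the join (cellwise multiset union) of a
`k₁`-latin square and a `k₂`-latin square with `k₁, k₂` positive and `k₁ + k₂ = k`. -/
def Separable (n k : ℕ) (L : Fin n → Fin n → Multiset (Fin n)) : Prop :=
  ∃ k1 k2 : ℕ, 0 < k1 ∧ 0 < k2 ∧ k1 + k2 = k ∧
    ∃ L1 L2 : Fin n → Fin n → Multiset (Fin n),
      IsMultiLatin n k1 L1 ∧ IsMultiLatin n k2 L2 ∧ ∀ i j, L i j = L1 i j + L2 i j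

/-- A `k`-latin square is erodable if it is the join of a `(k-1)`-latin square and a
latin square (a `1`-latin square). -/
def Erodable (n k : ℕ) (L : Fin n → Fin n → Multiset (Fin n)) : Prop :=
  ∃ L1 L2 : Fin n → Fin n → Multiset (Fin n),
    IsMultiLatin n (k - 1) L1 ∧ IsMultiLatin n 1 L2 ∧ ∀ i j, L i j = L1 i j + L2 i j

/-- A `k`-latin square is fully separable if it is the join of `k` latin squares. -/
def FullySeparable (n k : ℕ) (L : Fin n → Fin n → Multiset (Fin n)) : Prop :=
  ∃ M : Fin k → Fin n → Fin n → Multiset (Fin n),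
    (∀ t, IsMultiLatin n 1 (M t)) ∧ ∀ i j, L i j = ∑ t, M t i j

open Finset in
/-- **Row extension.** Pairwise disjoint injective rows `0, …, m - 1` of an array on `n > m`
symbols admit a further injective row disjoint from all of them. -/
theorem exists_latin_row {n m : ℕ} (hmn : m < n) (P : ℕ → Fin n → Fin n)
    (hrow : ∀ i < m, Function.Injective (P i))
    (hcol : ∀ j, ∀ i < m, ∀ i' < m, P i j = P i' j → i = i') :
    ∃ p : Fin n → Fin n, Function.Injective p ∧ ∀ i < m, ∀ j, P i j ≠ p j := by
  classical
  let A : Fin n → Finset (Fin n) := fun j => ((range m).image fun i => P i j)ᶜ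
  have memA : ∀ j s, s ∈ A j ↔ ∀ i < m, P i j ≠ s := by
    intro j s
    simp [A]
  have cardA : ∀ j, #(A j) = n - m := by
    intro j
    have : #((range m).image fun i => P i j) = m := by
      rw [card_image_of_injOn, card_range]
      intro i hi i' hi' h
      exact hcol j i (by simpa using hi) i' (by simpa using hi') h
    simp only [A, card_compl, this, Fintype.card_fin]
  have cardB : ∀ s, #{j | s ∈ A j} = n - m := by
    intro s
    have surj : ∀ i < m, ∃ j, P i j = s := fun i hi =>
      (Finite.injective_iff_surjective.mp (hrow i hi)) s
    have : Nonempty (Fin n) := ⟨s⟩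
    choose! q hq using surj
    have h1 : ({j | s ∈ A j} : Finset (Fin n)) = ((range m).image q)ᶜ := by
      ext j
      simp only [mem_filter, mem_univ, true_and, memA, mem_compl, mem_image, mem_range, not_exists,
        not_and]
      constructor
      · intro h i hi hij
        exact h i hi (hij ▸ hq i hi)
      · intro h i hi hij
        exact h i hi (hrow i hi ((hq i hi).trans hij.symm))
    rw [h1, card_compl, card_image_of_injOn, card_range, Fintype.card_fin]
    intro i hi i' hi' h
    have hi : i < m := by simpa using hi
    have hi' : i' < m := by simpa using hi'
    refine hcol (q i) i hi i' hi' ?_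
    rw [hq i hi]
    have h : q i = q i' := h
    rw [h, hq i' hi']
  have hall : ∀ J : Finset (Fin n), #J ≤ #(J.biUnion A) := by
    intro J
    have := card_mul_le_card_mul (s := J) (t := J.biUnion A) (fun j s => s ∈ A j)
      (m := n - m) (n := n - m) ?_ ?_
    · exact Nat.le_of_mul_le_mul_right this (by omega)
    · intro j hj
      rw [← cardA j]
      refine card_le_card fun s hs => ?_
      simp only [mem_bipartiteAbove, mem_biUnion]
      exact ⟨⟨j, hj, hs⟩, hs⟩
    · intro s _
      rw [← cardB s]
      refine card_le_card fun j hj => ?_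
      simp only [mem_bipartiteBelow] at hj
      simpa using hj.2
  obtain ⟨p, hp, hpA⟩ := (all_card_le_biUnion_card_iff_exists_injective A).mp hall
  exact ⟨p, hp, fun i hi j => (memA j _).mp (hpA j) i hi⟩

/-- Every latin rectangle can be completed to a latin square. -/
theorem exists_latin_square_extension {n m : ℕ} (hmn : m ≤ n) (P : ℕ → Fin n → Fin n)
    (hrow : ∀ i < m, Function.Injective (P i))
    (hcol : ∀ j, ∀ i < m, ∀ i' < m, P i j = P i' j → i = i') :
    ∃ Q : ℕ → Fin n → Fin n, (∀ i < m, Q i = P i) ∧ (∀ i < n, Function.Injective (Q i)) ∧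
      ∀ j, ∀ i < n, ∀ i' < n, Q i j = Q i' j → i = i' := by
  induction hmn using Nat.decreasingInduction generalizing P with
  | self => exact ⟨P, fun _ _ => rfl, hrow, hcol⟩
  | of_succ m hm ih =>
    obtain ⟨p, hp, hdisj⟩ := exists_latin_row hm P hrow hcol
    have hlt : ∀ i < m, Function.update P m p i = P i := fun i hi =>
      Function.update_of_ne hi.ne _ _
    have heq : Function.update P m p m = p := Function.update_self _ _ _
    have hrow' : ∀ i < m + 1, Function.Injective (Function.update P m p i) := by
      intro i hi
      rcases Nat.lt_succ_iff_lt_or_eq.mp hi with h | rfl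
      · rw [hlt i h]; exact hrow i h
      · rw [heq]; exact hp
    have hcol' : ∀ j, ∀ i < m + 1, ∀ i' < m + 1,
        Function.update P m p i j = Function.update P m p i' j → i = i' := by
      intro j i hi i' hi' h
      rcases Nat.lt_succ_iff_lt_or_eq.mp hi with h1 | h1 <;>
        rcases Nat.lt_succ_iff_lt_or_eq.mp hi' with h2 | h2
      · rw [hlt i h1, hlt i' h2] at h
        exact hcol j i h1 i' h2 h
      · rw [hlt i h1, h2, heq] at h
        exact absurd h (hdisj i h1 j)
      · rw [hlt i' h2, h1, heq] at h
        exact absurd h.symm (hdisj i' h2 j)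
      · rw [h1, h2]
    obtain ⟨Q, hQ, hQrow, hQcol⟩ := ih _ hrow' hcol'
    exact ⟨Q, fun i hi => (hQ i (by omega)).trans (hlt i hi), hQrow, hQcol⟩

/-- A `3 × 3` latin array on the symbols `0, 1, 2, 3`. -/
def corner : ℕ → ℕ → ℕ
  | 0, 0 => 0 | 0, 1 => 3 | 0, 2 => 1
  | 1, 0 => 3 | 1, 1 => 0 | 1, 2 => 2
  | 2, 0 => 1 | 2, 1 => 2 | 2, 2 => 3
  | _, _ => 0

/-- The first three rows of a latin square of order `n ≥ 6` extending `corner`. -/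
def cornerRows (n i j : ℕ) : ℕ :=
  if j < 3 then corner i j
  else if i + j < n then (if i + j = 3 then 2 else i + j)
  else if i + j = n then 2 - i else i + j - (n - 3)

theorem cornerRows_lt {n : ℕ} (hn : 6 ≤ n) {i j : ℕ} (hi : i < 3) (hj : j < n) :
    cornerRows n i j < n := by
  unfold cornerRows
  split_ifs with h
  · interval_cases i <;> interval_cases j <;> simp [corner] <;> omega
  all_goals omega

theorem cornerRows_injOn_row {n : ℕ} {i j j' : ℕ} (hi : i < 3) (hj : j < n)
    (hj' : j' < n) (h : cornerRows n i j = cornerRows n i j') : j = j' := by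
  unfold cornerRows at h
  by_cases h1 : j < 3 <;> by_cases h2 : j' < 3
  · rw [if_pos h1, if_pos h2] at h
    interval_cases i <;> interval_cases j <;> interval_cases j' <;> simp_all [corner]
  · rw [if_pos h1, if_neg h2] at h
    interval_cases i <;> interval_cases j <;> simp only [corner] at h <;> split_ifs at h <;> omega
  · rw [if_neg h1, if_pos h2] at h
    interval_cases i <;> interval_cases j' <;> simp only [corner] at h <;> split_ifs at h <;> omega
  · rw [if_neg h1, if_neg h2] at h
    split_ifs at h <;> omega

theorem cornerRows_injOn_column {n : ℕ} (hn : 6 ≤ n) {i i' j : ℕ} (hi : i < 3) (hi' : i' < 3)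
    (hj : j < n) (h : cornerRows n i j = cornerRows n i' j) : i = i' := by
  unfold cornerRows at h
  by_cases h1 : j < 3
  · rw [if_pos h1, if_pos h1] at h
    interval_cases i <;> interval_cases j <;> interval_cases i' <;> simp_all [corner]
  · rw [if_neg h1, if_neg h1] at h
    split_ifs at h <;> omega

/-- For `n ≥ 6` there is a latin square of order `n` whose top left corner is `corner`. -/
theorem exists_latin_square_corner {n : ℕ} (hn : 6 ≤ n) :
    ∃ l : Fin n → Fin n → Fin n, (∀ i, Function.Injective (l i)) ∧
      (∀ j, Function.Injective fun i => l i j) ∧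
      ∀ i j : Fin n, (i : ℕ) < 3 → (j : ℕ) < 3 → (l i j : ℕ) = corner i j := by
  let P : ℕ → Fin n → Fin n := fun i j =>
    if hi : i < 3 then ⟨cornerRows n i j, cornerRows_lt hn hi j.2⟩ else j
  have hP : ∀ i < 3, ∀ j, (P i j : ℕ) = cornerRows n i j := by
    intro i hi j
    simp [P, hi]
  obtain ⟨Q, hQ, hrow, hcol⟩ := exists_latin_square_extension (m := 3) (by omega) P
    (fun i hi j j' h => Fin.ext <| cornerRows_injOn_row hi j.2 j'.2 <| by
      rw [← hP i hi, ← hP i hi, h])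
    (fun j i hi i' hi' h => cornerRows_injOn_column hn hi hi' j.2 <| by
      rw [← hP i hi, ← hP i' hi', h])
  refine ⟨fun i => Q i, fun i => hrow i i.2, fun j i i' h => Fin.ext (hcol j i i.2 i' i'.2 h), ?_⟩
  intro i j hi hj
  simp only [hQ i hi]
  rw [hP i hi, cornerRows, if_pos hj]

/-- An array with vanishing line sums, negative only on the entries of `corner`. -/
def trade : ℕ → ℕ → ℕ → ℤ
  | 0, 0, 0 => -1 | 0, 0, 1 => 1
  | 0, 1, 3 => -1 | 0, 1, 0 => 1
  | 0, 2, 1 => -1 | 0, 2, 3 => 1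
  | 1, 0, 3 => -1 | 1, 0, 0 => 1
  | 1, 1, 0 => -1 | 1, 1, 2 => 1
  | 1, 2, 2 => -1 | 1, 2, 3 => 1
  | 2, 0, 1 => -1 | 2, 0, 3 => 1
  | 2, 1, 2 => -1 | 2, 1, 3 => 1
  | 2, 2, 3 => -2 | 2, 2, 1 => 1 | 2, 2, 2 => 1
  | _, _, _ => 0

theorem lt_of_trade_ne_zero {i j s : ℕ} (h : trade i j s ≠ 0) : i < 3 ∧ j < 3 ∧ s < 4 := by
  unfold trade at h
  split at h <;> simp_all

theorem neg_two_le_trade (i j s : ℕ) : -2 ≤ trade i j s := by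
  unfold trade
  split <;> simp

theorem eq_corner_of_trade_neg {i j s : ℕ} (h : trade i j s < 0) : s = corner i j := by
  unfold trade at h
  split at h <;> simp_all [corner]

theorem cases_of_trade_pos {i j s : ℕ} (h : 0 < trade i j s) :
    (i = 0 ∧ j = 0 ∧ s = 1) ∨ (i = 0 ∧ j = 1 ∧ s = 0) ∨ (i = 0 ∧ j = 2 ∧ s = 3) ∨
    (i = 1 ∧ j = 0 ∧ s = 0) ∨ (i = 1 ∧ j = 1 ∧ s = 2) ∨ (i = 1 ∧ j = 2 ∧ s = 3) ∨
    (i = 2 ∧ j = 0 ∧ s = 3) ∨ (i = 2 ∧ j = 1 ∧ s = 3) ∨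
    (i = 2 ∧ j = 2 ∧ s = 1) ∨ (i = 2 ∧ j = 2 ∧ s = 2) := by
  unfold trade at h
  split at h <;> simp_all

theorem sum_fin_eq_sum_range_four {n : ℕ} (hn : 4 ≤ n) (g : ℕ → ℤ) (hg : ∀ a, g a ≠ 0 → a < 4) :
    ∑ a : Fin n, g a = ∑ a ∈ Finset.range 4, g a := by
  rw [Fin.sum_univ_eq_sum_range]
  symm
  refine Finset.sum_subset (by simpa using hn) fun a _ ha => ?_
  by_contra h
  exact ha (by simpa using hg a h)

theorem sum_trade_symbol {n : ℕ} (hn : 4 ≤ n) (i j : ℕ) : ∑ s : Fin n, trade i j s = 0 := by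
  rw [sum_fin_eq_sum_range_four hn _ fun s h => (lt_of_trade_ne_zero h).2.2]
  by_cases h : i < 3 ∧ j < 3
  · obtain ⟨hi, hj⟩ := h
    interval_cases i <;> interval_cases j <;> rfl
  · refine Finset.sum_eq_zero fun s _ => ?_
    by_contra h'
    have := lt_of_trade_ne_zero h'
    omega

theorem sum_trade_column {n : ℕ} (hn : 4 ≤ n) (i s : ℕ) : ∑ j : Fin n, trade i j s = 0 := by
  rw [sum_fin_eq_sum_range_four hn (fun j => trade i j s) fun j h =>
    (lt_of_trade_ne_zero h).2.1.trans (by norm_num)]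
  by_cases h : i < 3 ∧ s < 4
  · obtain ⟨hi, hs⟩ := h
    interval_cases i <;> interval_cases s <;> rfl
  · refine Finset.sum_eq_zero fun j _ => ?_
    by_contra h'
    have := lt_of_trade_ne_zero h'
    omega

theorem sum_trade_row {n : ℕ} (hn : 4 ≤ n) (j s : ℕ) : ∑ i : Fin n, trade i j s = 0 := by
  rw [sum_fin_eq_sum_range_four hn (fun i => trade i j s) fun i h =>
    (lt_of_trade_ne_zero h).1.trans (by norm_num)]
  by_cases h : j < 3 ∧ s < 4
  · obtain ⟨hj, hs⟩ := h
    interval_cases j <;> interval_cases s <;> rfl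
  · refine Finset.sum_eq_zero fun i _ => ?_
    by_contra h'
    have := lt_of_trade_ne_zero h'
    omega

/-- The array of multisets in which symbol `s` has multiplicity `c i j s` in cell `(i, j)`. -/
def arrayOfCounts {n : ℕ} (c : Fin n → Fin n → Fin n → ℕ) (i j : Fin n) : Multiset (Fin n) :=
  ∑ s, Multiset.replicate (c i j s) s

theorem count_arrayOfCounts {n : ℕ} (c : Fin n → Fin n → Fin n → ℕ) (i j s : Fin n) :
    (arrayOfCounts c i j).count s = c i j s := by
  simp [arrayOfCounts, Multiset.count_sum', Multiset.count_replicate]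

theorem isMultiLatin_arrayOfCounts {n k : ℕ} {c : Fin n → Fin n → Fin n → ℕ}
    (hsym : ∀ i j, ∑ s, c i j s = k) (hcol : ∀ i s, ∑ j, c i j s = k)
    (hrow : ∀ j s, ∑ i, c i j s = k) : IsMultiLatin n k (arrayOfCounts c) := by
  refine ⟨fun i j => ?_, fun i s => ?_, fun j s => ?_⟩
  · simp [arrayOfCounts, hsym]
  · simp [count_arrayOfCounts, hcol]
  · simp [count_arrayOfCounts, hrow]

/-- A `1`-latin square is given by a latin square in the usual sense. -/
theorem IsMultiLatin.exists_eq_singleton {n : ℕ} {M : Fin n → Fin n → Multiset (Fin n)}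
    (hM : IsMultiLatin n 1 M) :
    ∃ f : Fin n → Fin n → Fin n, (∀ i j, M i j = {f i j}) ∧ (∀ i, Function.Injective (f i)) ∧
      ∀ j, Function.Injective fun i => f i j := by
  obtain ⟨hcard, hrow, hcol⟩ := hM
  choose f hf using fun i j => Multiset.card_eq_one.mp (hcard i j)
  refine ⟨f, hf, fun i j j' h => ?_, fun j i i' h => ?_⟩
  · by_contra hne
    have h2 := Finset.sum_le_sum_of_subset (f := fun a => (M i a).count (f i j))
      (Finset.subset_univ {j, j'})
    rw [hrow, Finset.sum_pair hne, hf, hf, ← h] at h2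
    simp at h2
  · by_contra hne
    have h : f i j = f i' j := h
    have h2 := Finset.sum_le_sum_of_subset (f := fun a => (M a j).count (f i j))
      (Finset.subset_univ {i, i'})
    rw [hcol, Finset.sum_pair hne, hf, hf, ← h] at h2
    simp at h2

theorem FullySeparable.exists_latin {n k : ℕ} {L : Fin n → Fin n → Multiset (Fin n)}
    (hL : FullySeparable n k L) :
    ∃ f : Fin k → Fin n → Fin n → Fin n, (∀ t i, Function.Injective (f t i)) ∧
      (∀ t j, Function.Injective fun i => f t i j) ∧ (∀ t i j, f t i j ∈ L i j) ∧
      ∀ i j s, (∀ t, f t i j = s) → (L i j).count s = k := by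
  obtain ⟨M, hM, hsum⟩ := hL
  choose f hf hrow hcol using fun t => (hM t).exists_eq_singleton
  refine ⟨f, hrow, hcol, fun t i j => ?_, fun i j s h => ?_⟩
  · rw [hsum, Multiset.mem_sum]
    exact ⟨t, Finset.mem_univ t, by simp [hf]⟩
  · simp [hsum, hf, h]

/-- A latin square whose entries lie in the support of `corner` and the positive part of `trade`
has symbol `3` in cell `(2, 2)`. -/
theorem apply_two_two_eq_three {n : ℕ} (hn : 3 ≤ n) {f : Fin n → Fin n → Fin n}
    (hrow : ∀ i, Function.Injective (f i)) (hcol : ∀ j, Function.Injective fun i => f i j)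
    (hmem : ∀ i j : Fin n, (i : ℕ) < 3 → (j : ℕ) < 3 →
      (f i j : ℕ) = corner i j ∨ 0 < trade i j (f i j)) :
    (f ⟨2, by omega⟩ ⟨2, by omega⟩ : ℕ) = 3 := by
  obtain ⟨g, hg⟩ : ∃ g : Fin 3 → Fin 3 → ℕ,
      ∀ i j, g i j = f ⟨i, by omega⟩ ⟨j, by omega⟩ := ⟨_, fun _ _ => rfl⟩
  have hgrow : ∀ i j j', j ≠ j' → g i j ≠ g i j' := by
    intro i j j' hne h
    rw [hg, hg] at h
    exact hne (Fin.ext (by simpa using hrow _ (Fin.ext h)))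
  have hgcol : ∀ j i i', i ≠ i' → g i j ≠ g i' j := by
    intro j i i' hne h
    rw [hg, hg] at h
    exact hne (Fin.ext (by simpa using hcol _ (Fin.ext h)))
  have hgmem : ∀ i j : Fin 3, g i j = corner i j ∨ 0 < trade i j (g i j) := by
    intro i j
    rw [hg]
    exact hmem _ _ i.2 j.2
  have c00 : g 0 0 = 0 ∨ g 0 0 = 1 :=
    (hgmem 0 0).imp id fun h => by simpa using cases_of_trade_pos h
  have c01 : g 0 1 = 3 ∨ g 0 1 = 0 :=
    (hgmem 0 1).imp id fun h => by simpa using cases_of_trade_pos h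
  have c02 : g 0 2 = 1 ∨ g 0 2 = 3 :=
    (hgmem 0 2).imp id fun h => by simpa using cases_of_trade_pos h
  have c10 : g 1 0 = 3 ∨ g 1 0 = 0 :=
    (hgmem 1 0).imp id fun h => by simpa using cases_of_trade_pos h
  have c11 : g 1 1 = 0 ∨ g 1 1 = 2 :=
    (hgmem 1 1).imp id fun h => by simpa using cases_of_trade_pos h
  have c12 : g 1 2 = 2 ∨ g 1 2 = 3 :=
    (hgmem 1 2).imp id fun h => by simpa using cases_of_trade_pos h
  have c20 : g 2 0 = 1 ∨ g 2 0 = 3 :=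
    (hgmem 2 0).imp id fun h => by simpa using cases_of_trade_pos h
  have c21 : g 2 1 = 2 ∨ g 2 1 = 3 :=
    (hgmem 2 1).imp id fun h => by simpa using cases_of_trade_pos h
  have c22 : g 2 2 = 3 ∨ g 2 2 = 1 ∨ g 2 2 = 2 :=
    (hgmem 2 2).imp id fun h => by simpa using cases_of_trade_pos h
  have goal : g 2 2 = 3 := by
    have r0 := hgrow 0 0 1 (by decide)
    have r0' := hgrow 0 0 2 (by decide)
    have r0'' := hgrow 0 1 2 (by decide)
    have r1 := hgrow 1 0 1 (by decide)
    have r1' := hgrow 1 0 2 (by decide)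
    have r1'' := hgrow 1 1 2 (by decide)
    have r2 := hgrow 2 0 1 (by decide)
    have r2' := hgrow 2 0 2 (by decide)
    have r2'' := hgrow 2 1 2 (by decide)
    have s0 := hgcol 0 0 1 (by decide)
    have s0' := hgcol 0 0 2 (by decide)
    have s0'' := hgcol 0 1 2 (by decide)
    have s1 := hgcol 1 0 1 (by decide)
    have s1' := hgcol 1 0 2 (by decide)
    have s1'' := hgcol 1 1 2 (by decide)
    have s2 := hgcol 2 0 1 (by decide)
    have s2' := hgcol 2 0 2 (by decide)
    have s2'' := hgcol 2 1 2 (by decide)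
    grind
  rw [hg] at goal
  exact goal

theorem exists_not_fullySeparable_of_six_le {n k : ℕ} (hk : 2 ≤ k) (hn : 6 ≤ n) :
    ∃ L : Fin n → Fin n → Multiset (Fin n), IsMultiLatin n k L ∧ ¬ FullySeparable n k L := by
  obtain ⟨l, hrow, hcol, hcorner⟩ := exists_latin_square_corner hn
  let c : Fin n → Fin n → Fin n → ℕ := fun i j s =>
    ((if l i j = s then (k : ℤ) else 0) + trade i j s).toNat
  have hc : ∀ i j s, (c i j s : ℤ) = (if l i j = s then (k : ℤ) else 0) + trade i j s := by
    intro i j s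
    refine Int.toNat_of_nonneg ?_
    split_ifs with h
    · have := neg_two_le_trade i j s
      omega
    · by_contra hlt
      have hneg : trade i j s < 0 := by omega
      have hlt3 := lt_of_trade_ne_zero hneg.ne
      exact h (Fin.ext ((hcorner i j hlt3.1 hlt3.2.1).trans (eq_corner_of_trade_neg hneg).symm))
  have hsurj : ∀ i s, ∃ j, l i j = s := fun i =>
    Finite.injective_iff_surjective.mp (hrow i)
  have hsurj' : ∀ j s, ∃ i, l i j = s := fun j =>
    Finite.injective_iff_surjective.mp (hcol j)
  refine ⟨arrayOfCounts c, isMultiLatin_arrayOfCounts ?_ ?_ ?_, fun hsep => ?_⟩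
  · intro i j
    zify
    simp [hc, Finset.sum_add_distrib, sum_trade_symbol (show 4 ≤ n by omega)]
  · intro i s
    zify
    obtain ⟨j, hj⟩ := hsurj i s
    have : ∀ j', l i j' = s ↔ j' = j := fun j' => by rw [← hj, (hrow i).eq_iff]
    simp [hc, Finset.sum_add_distrib, sum_trade_column (show 4 ≤ n by omega), this]
  · intro j s
    zify
    obtain ⟨i, hi⟩ := hsurj' j s
    have : ∀ i', l i' j = s ↔ i' = i := fun i' => by rw [← hi]; exact (hcol j).eq_iff
    simp [hc, Finset.sum_add_distrib, sum_trade_row (show 4 ≤ n by omega), this]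
  · obtain ⟨f, hfrow, hfcol, hmem, hcount⟩ := hsep.exists_latin
    have h3 : ∀ t, f t ⟨2, by omega⟩ ⟨2, by omega⟩ = ⟨3, by omega⟩ := by
      intro t
      refine Fin.ext (apply_two_two_eq_three (by omega) (hfrow t) (hfcol t) fun i j hi hj => ?_)
      have hpos := Multiset.count_pos.mpr (hmem t i j)
      rw [count_arrayOfCounts] at hpos
      zify at hpos
      rw [hc] at hpos
      split_ifs at hpos with h
      · left
        rw [← h, hcorner i j hi hj]
      · right
        simpa using hpos
    have := hcount _ _ _ h3
    rw [count_arrayOfCounts] at this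
    zify at this
    rw [hc, if_pos (Fin.ext (hcorner _ _ (by simp) (by simp)))] at this
    simp [trade] at this

/-- A `2`-latin square of order `5` whose support contains no latin square. -/
def twoLatinFive : Fin 5 → Fin 5 → Multiset (Fin 5) :=
  ![![{2, 2}, {1, 3}, {3, 4}, {0, 0}, {1, 4}],
    ![{1, 1}, {0, 0}, {2, 3}, {3, 4}, {2, 4}],
    ![{0, 0}, {1, 3}, {2, 4}, {3, 4}, {1, 2}],
    ![{3, 3}, {4, 4}, {1, 1}, {2, 2}, {0, 0}],
    ![{4, 4}, {2, 2}, {0, 0}, {1, 1}, {3, 3}]]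

theorem isMultiLatin_twoLatinFive : IsMultiLatin 5 2 twoLatinFive := by
  refine ⟨?_, ?_, ?_⟩ <;> decide

theorem not_fullySeparable_twoLatinFive : ¬ FullySeparable 5 2 twoLatinFive := by
  intro hsep
  obtain ⟨f, hrow, hcol, hmem, -⟩ := hsep.exists_latin
  have hrow : ∀ i j j', j ≠ j' → f 0 i j ≠ f 0 i j' := fun i j j' h => (hrow 0 i).ne h
  have hcol : ∀ j i i', i ≠ i' → f 0 i j ≠ f 0 i' j := fun j i i' h => (hcol 0 j).ne h
  have c01 : f 0 0 1 = 1 ∨ f 0 0 1 = 3 := by simpa [twoLatinFive] using hmem 0 0 1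
  have c02 : f 0 0 2 = 3 ∨ f 0 0 2 = 4 := by simpa [twoLatinFive] using hmem 0 0 2
  have c04 : f 0 0 4 = 1 ∨ f 0 0 4 = 4 := by simpa [twoLatinFive] using hmem 0 0 4
  have c12 : f 0 1 2 = 2 ∨ f 0 1 2 = 3 := by simpa [twoLatinFive] using hmem 0 1 2
  have c21 : f 0 2 1 = 1 ∨ f 0 2 1 = 3 := by simpa [twoLatinFive] using hmem 0 2 1
  have c22 : f 0 2 2 = 2 ∨ f 0 2 2 = 4 := by simpa [twoLatinFive] using hmem 0 2 2
  have c23 : f 0 2 3 = 3 ∨ f 0 2 3 = 4 := by simpa [twoLatinFive] using hmem 0 2 3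
  have c24 : f 0 2 4 = 1 ∨ f 0 2 4 = 2 := by simpa [twoLatinFive] using hmem 0 2 4
  have r1 := hrow 0 1 2 (by decide)
  have r2 := hrow 0 1 4 (by decide)
  have r3 := hrow 0 2 4 (by decide)
  have r4 := hrow 2 1 4 (by decide)
  have r5 := hrow 2 2 4 (by decide)
  have r6 := hrow 2 1 3 (by decide)
  have r7 := hrow 2 2 3 (by decide)
  have s1 := hcol 1 0 2 (by decide)
  have s2 := hcol 2 0 1 (by decide)
  have s3 := hcol 2 0 2 (by decide)
  have s4 := hcol 2 1 2 (by decide)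
  have s5 := hcol 4 0 2 (by decide)
  grind

/-- For all `k ≥ 2` and `n ≥ 2k + 1`, there exists a `k`-latin square of order `n`
which is not fully separable (not a join of `k` latin squares). -/
theorem stmt_11 (k n : ℕ) (hk : 2 ≤ k) (hn : 2 * k + 1 ≤ n) :
    ∃ L : Fin n → Fin n → Multiset (Fin n),
      IsMultiLatin n k L ∧ ¬ FullySeparable n k L := by
  rcases Nat.lt_or_ge n 6 with h | h
  · obtain rfl : k = 2 := by omega
    obtain rfl : n = 5 := by omega
    exact ⟨twoLatinFive, isMultiLatin_twoLatinFive, not_fullySeparable_twoLatinFive⟩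
  · exact exists_not_fullySeparable_of_six_le hk h
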